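/- arXiv:1509.03275 — 2 statements merged into one kernel-verified Lean document; each statement's English description precedes it below -/
import Mathlib

section
/- Suppose k is an algebraically closed field of characteristic 0, σ is a field automorphism of k, and F : Φ → k. Then F is gauge equivalent to its Galois conjugate σ∘F if and only if σ(F(m)) = F(m) for every invariant monomial m whose support is contained in {φ ∈ Φ : F(φ) ≠ 0}. -/
open Finsupp

/-- The unique additive homomorphism `(Φ →₀ ℤ) →+ (Γ →₀ ℤ)` sending `single φ 1` to `t φ`. -/
noncomputable def tA {Φ Γ : Type*} (t : Φ → (Γ →₀ ℤ)) : (Φ →₀ ℤ) →+ (Γ →₀ ℤ) :=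
  Finsupp.liftAddHom fun φ => zmultiplesHom _ (t φ)

theorem tA_single {Φ Γ : Type*} (t : Φ → (Γ →₀ ℤ)) (φ : Φ) :
    tA t (Finsupp.single φ 1) = t φ := by
  simp [tA]

/-- The action of a gauge transformation `g : Γ → kˣ` on `F : Φ → k`. -/
noncomputable def gaugeAct {k : Type*} [Field k] {Φ Γ : Type*} [Fintype Γ]
    (t : Φ → (Γ →₀ ℤ)) (g : Γ → kˣ) (F : Φ → k) : Φ → k :=
  fun φ => ((∏ γ : Γ, g γ ^ (t φ) γ : kˣ) : k) * F φ

/-- Gauge equivalence of `F, F' : Φ → k`. -/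
def gaugeEquiv {k : Type*} [Field k] {Φ Γ : Type*} [Fintype Γ]
    (t : Φ → (Γ →₀ ℤ)) (F F' : Φ → k) : Prop :=
  ∃ g : Γ → kˣ, F' = gaugeAct t g F

/-- Evaluation of a monomial `m : Φ →₀ ℤ` at a point `F : Φ → k`. -/
noncomputable def evalMon {k : Type*} [Field k] {Φ : Type*} [Fintype Φ] (F : Φ → k) (m : Φ →₀ ℤ) : k :=
  ∏ φ : Φ, F φ ^ m φ

/-- The action of a permutation of `Φ` on `F : Φ → k`. -/
def permAct {k Φ : Type*} (ρ : Equiv.Perm Φ) (F : Φ → k) : Φ → k :=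
  fun φ => F (ρ.symm φ)


/-- A divisible abelian group is injective: a homomorphism vanishing on the kernel of `f` factors
through `f`. -/
theorem exists_comp_eq_of_ker_le {M N A : Type*} [AddCommGroup M] [AddCommGroup N]
    [AddCommGroup A] [DivisibleBy A ℤ] (f : M →+ N) (h : M →+ A) (hker : f.ker ≤ h.ker) :
    ∃ e : N →+ A, ∀ x, e (f x) = h x := by
  obtain ⟨e, he⟩ := (Module.Baer.of_divisible A).extension_property_addMonoidHom
    (QuotientAddGroup.kerLift f) (QuotientAddGroup.kerLift_injective f)
    (QuotientAddGroup.lift f.ker h hker)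
  exact ⟨e, fun x => DFunLike.congr_fun he (x : M ⧸ f.ker)⟩

/-- The multiplicative group of an algebraically closed field is divisible. -/
@[reducible]
noncomputable def IsAlgClosed.divisibleByAdditiveUnits (k : Type*) [Field k] [IsAlgClosed k] :
    DivisibleBy (Additive kˣ) ℤ :=
  haveI : DivisibleBy (Additive kˣ) ℕ := divisibleByOfSMulRightSurj _ _ fun {n} hn x => by
    obtain ⟨z, hz⟩ := IsAlgClosed.exists_pow_nat_eq (x.toMul : k) (Nat.pos_of_ne_zero hn)
    have hz0 : z ≠ 0 := by
      rintro rfl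
      exact x.toMul.ne_zero (by rw [← hz, zero_pow hn])
    refine ⟨Additive.ofMul (Units.mk0 z hz0), ?_⟩
    apply Additive.toMul.injective
    ext
    simpa using hz
  AddGroup.divisibleByIntOfDivisibleByNat _

theorem tA_apply {Φ Γ : Type*} [Fintype Φ] (t : Φ → (Γ →₀ ℤ)) (m : Φ →₀ ℤ) (γ : Γ) :
    tA t m γ = ∑ φ, m φ * t φ γ := by
  simp [tA, Finsupp.sum_fintype, Finsupp.finsetSum_apply]

theorem map_evalMon {k : Type*} [Field k] {Φ : Type*} [Fintype Φ] (σ : k ≃+* k) (F : Φ → k)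
    (m : Φ →₀ ℤ) : σ (evalMon F m) = evalMon (fun φ => σ (F φ)) m := by
  simp [evalMon, map_prod, map_zpow₀]

theorem evalMon_gaugeAct {k : Type*} [Field k] {Φ Γ : Type*} [Fintype Φ] [Fintype Γ]
    (t : Φ → (Γ →₀ ℤ)) (g : Γ → kˣ) (F : Φ → k) (m : Φ →₀ ℤ) :
    evalMon (gaugeAct t g F) m = ((∏ γ, g γ ^ tA t m γ : kˣ) : k) * evalMon F m := by
  have key : (∏ γ, g γ ^ tA t m γ : kˣ) = ∏ φ, (∏ γ, g γ ^ t φ γ) ^ m φ := by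
    simp_rw [← Finset.prod_zpow, ← zpow_mul]
    rw [Finset.prod_comm]
    refine Finset.prod_congr rfl fun γ _ => ?_
    rw [tA_apply]
    simp_rw [mul_comm (m _)]
    exact map_sum (zpowersHom kˣ (g γ)).toAdditiveRight _ _
  rw [key]
  simp only [evalMon, gaugeAct, mul_zpow, Finset.prod_mul_distrib, Units.coe_prod,
    Units.val_zpow_eq_zpow_val]

theorem evalMon_mapDomain_subtype {k : Type*} [Field k] {Φ : Type*} [Fintype Φ] {p : Φ → Prop}
    (F : Φ → k) (m : {φ // p φ} →₀ ℤ) :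
    evalMon F (m.mapDomain Subtype.val) = m.prod fun φ n => F φ ^ n := by
  rw [evalMon, ← Finsupp.prod_fintype _ (fun φ n => F φ ^ n) fun _ => zpow_zero _,
    Finsupp.prod_mapDomain_index_inj Subtype.val_injective]

/-- Points with the same vanishing locus on which all invariant monomials agree are gauge
equivalent. -/
theorem gaugeEquiv_of_evalMon_eq {k : Type*} [Field k] [IsAlgClosed k] {Φ Γ : Type*} [Fintype Φ]
    [Fintype Γ] (t : Φ → (Γ →₀ ℤ)) (F F' : Φ → k) (hFF' : ∀ φ, F φ = 0 ↔ F' φ = 0)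
    (h : ∀ m : Φ →₀ ℤ, tA t m = 0 → (∀ φ ∈ m.support, F φ ≠ 0) → evalMon F' m = evalMon F m) :
    gaugeEquiv t F F' := by
  classical
  let := IsAlgClosed.divisibleByAdditiveUnits k
  let u : {φ // F φ ≠ 0} → kˣ := fun φ =>
    Units.mk0 (F' φ / F φ) (div_ne_zero (fun h0 => φ.2 ((hFF' φ).2 h0)) φ.2)
  let ratio : ({φ // F φ ≠ 0} →₀ ℤ) →+ Additive kˣ :=
    Finsupp.liftAddHom fun φ => zmultiplesHom _ (Additive.ofMul (u φ))
  have hratio (m : {φ // F φ ≠ 0} →₀ ℤ) :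
      ratio m = Additive.ofMul (m.prod fun φ n => u φ ^ n) := by
    simp [ratio, Finsupp.sum, Finsupp.prod, ofMul_prod]
  obtain ⟨e, he⟩ := exists_comp_eq_of_ker_le
    ((tA t).comp (Finsupp.mapDomain.addMonoidHom Subtype.val)) ratio fun m hm => by
      rw [AddMonoidHom.mem_ker] at hm ⊢
      have hsupp : ∀ φ ∈ (m.mapDomain Subtype.val).support, F φ ≠ 0 := fun φ hφ => by
        obtain ⟨ψ, -, rfl⟩ := Finset.mem_image.1 (Finsupp.mapDomain_support hφ)
        exact ψ.2
      have hm' : evalMon F' (m.mapDomain Subtype.val) = evalMon F (m.mapDomain Subtype.val) :=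
        h _ hm hsupp
      rw [evalMon_mapDomain_subtype, evalMon_mapDomain_subtype] at hm'
      rw [hratio, ofMul_eq_zero]
      ext
      simp only [Finsupp.prod, u, Units.coe_prod, Units.val_zpow_eq_zpow_val, Units.val_mk0,
        div_zpow, Finset.prod_div_distrib, Units.val_one] at hm' ⊢
      rw [hm', div_self]
      exact Finset.prod_ne_zero_iff.2 fun φ _ => zpow_ne_zero _ φ.2
  have hexpand (x : Γ →₀ ℤ) :
      e x = Additive.ofMul (∏ γ, (e (Finsupp.single γ 1)).toMul ^ x γ) := by
    conv_lhs => rw [← Finsupp.univ_sum_single x, map_sum]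
    rw [ofMul_prod]
    refine Finset.sum_congr rfl fun γ _ => ?_
    rw [ofMul_zpow, ofMul_toMul, ← map_zsmul, Finsupp.smul_single, smul_eq_mul, mul_one]
  refine ⟨fun γ => (e (Finsupp.single γ 1)).toMul, funext fun φ => ?_⟩
  by_cases hφ : F φ = 0
  · rw [gaugeAct, hφ, mul_zero, (hFF' φ).1 hφ]
  · have hu : ∏ γ, (e (Finsupp.single γ 1)).toMul ^ t φ γ = u ⟨φ, hφ⟩ := by
      have := he (Finsupp.single ⟨φ, hφ⟩ 1)
      rw [hratio, AddMonoidHom.comp_apply, Finsupp.mapDomain.addMonoidHom_apply,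
        Finsupp.mapDomain_single, tA_single, hexpand] at this
      simpa [-ofMul_prod] using Additive.ofMul.injective this
    rw [gaugeAct, hu, Units.val_mk0, div_mul_cancel₀ _ hφ]

/-- A point is gauge equivalent to its Galois conjugate iff all of its invariant-monomial
evaluations are fixed by the field automorphism. -/
theorem gaugeEquiv_galoisConjugate_iff {k : Type*} [Field k] [IsAlgClosed k] [CharZero k]
    {Φ Γ : Type*} [Fintype Φ] [Fintype Γ] (t : Φ → (Γ →₀ ℤ)) (σ : k ≃+* k) (F : Φ → k) :
    gaugeEquiv t F (fun φ => σ (F φ)) ↔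
      ∀ m : Φ →₀ ℤ, tA t m = 0 → (∀ φ ∈ m.support, F φ ≠ 0) →
        σ (evalMon F m) = evalMon F m := by
  simp_rw [map_evalMon]
  constructor
  · rintro ⟨g, hg⟩ m hm -
    rw [hg, evalMon_gaugeAct, hm]
    simp
  · exact gaugeEquiv_of_evalMon_eq t F _ fun φ => (map_eq_zero_iff σ σ.injective).symm
end

section
/- Suppose k is an algebraically closed field of characteristic 0. If F, F' : Φ → k are not gauge equivalent but have the same zero set {φ : F(φ) = 0} = {φ : F'(φ) = 0}, then there exists an invariant monomial m with support contained in {φ : F(φ) ≠ 0} such that F(m) ≠ F'(m); that is, any two distinct gauge classes with a common zero set are separated by the evaluation of some invariant monomial. -/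
open Finsupp

/-- The unit group of an algebraically closed field is divisible. -/
theorem IsAlgClosed.units_pow_surjective (k : Type*) [Field k] [IsAlgClosed k] {n : ℕ}
    (hn : n ≠ 0) : Function.Surjective fun a : kˣ => a ^ n := fun a => by
  obtain ⟨z, hz⟩ := IsAlgClosed.exists_pow_nat_eq (a : k) (Nat.pos_of_ne_zero hn)
  have hz0 : z ≠ 0 := by
    rintro rfl
    rw [zero_pow hn] at hz
    exact a.ne_zero hz.symm
  exact ⟨Units.mk0 z hz0, Units.ext (by simpa using hz)⟩

/-- The additive group `Additive kˣ` satisfies Baer's criterion over `ℤ`. -/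
theorem IsAlgClosed.baer_additive_units (k : Type*) [Field k] [IsAlgClosed k] :
    Module.Baer ℤ (Additive kˣ) := by
  let : RootableBy kˣ ℕ := rootableByOfPowLeftSurj _ _ (IsAlgClosed.units_pow_surjective k)
  let : RootableBy kˣ ℤ := Group.rootableByIntOfRootableByNat kˣ
  let : DivisibleBy (Additive kˣ) ℤ :=
    { div := fun a n => Additive.ofMul (RootableBy.root a.toMul n)
      div_zero := fun a => congrArg Additive.ofMul (RootableBy.root_zero a.toMul)
      div_cancel := fun a hn => congrArg Additive.ofMul (RootableBy.root_cancel a.toMul hn) }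
  exact Module.Baer.of_divisible _

/-- A linear map into a module satisfying Baer's criterion factors through every linear map with
smaller kernel. -/
theorem Module.Baer.exists_comp_eq_of_ker_le {R Q M N : Type*} [CommRing R] [AddCommGroup Q]
    [Module R Q] [AddCommGroup M] [Module R M] [AddCommGroup N] [Module R N]
    (hQ : Module.Baer R Q) (f : M →ₗ[R] N) (g : M →ₗ[R] Q)
    (h : LinearMap.ker f ≤ LinearMap.ker g) : ∃ e : N →ₗ[R] Q, e ∘ₗ f = g := by
  obtain ⟨e, he⟩ := hQ.extension_property ((LinearMap.ker f).liftQ f le_rfl)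
    (LinearMap.ker_eq_bot.mp (Submodule.ker_liftQ_eq_bot' _ _ rfl)) ((LinearMap.ker f).liftQ g h)
  refine ⟨e, LinearMap.ext fun x => ?_⟩
  simpa using LinearMap.congr_fun he (Submodule.Quotient.mk x)

/-- Functions into a field with the same zero set differ by a unit-valued function. -/
theorem exists_units_mul_eq_of_zero_set_eq {k Φ : Type*} [Field k] {F F' : Φ → k}
    (hz : ∀ φ, F φ = 0 ↔ F' φ = 0) : ∃ u : Φ → kˣ, ∀ φ, F' φ = u φ * F φ := by
  have h (φ : Φ) : ∃ u : kˣ, F' φ = u * F φ := by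
    by_cases h0 : F φ = 0
    · exact ⟨1, by simp [h0, (hz φ).mp h0]⟩
    · exact ⟨Units.mk0 (F' φ / F φ) (div_ne_zero (mt (hz φ).mpr h0) h0), by simp [h0]⟩
  choose u hu using h
  exact ⟨u, hu⟩

theorem evalMon_ne_zero {k Φ : Type*} [Field k] [Fintype Φ] {F : Φ → k} {m : Φ →₀ ℤ}
    (h : ∀ φ ∈ m.support, F φ ≠ 0) : evalMon F m ≠ 0 := by
  refine Finset.prod_ne_zero_iff.mpr fun φ _ => ?_
  by_cases hm : m φ = 0
  · simp [hm]
  · exact zpow_ne_zero _ (h φ (Finsupp.mem_support_iff.mpr hm))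

/-- The homomorphism `(Φ →₀ ℤ) →+ Additive kˣ` sending `single φ 1` to `u φ`. -/
noncomputable def unitsEval {k Φ : Type*} [Field k] (u : Φ → kˣ) : (Φ →₀ ℤ) →+ Additive kˣ :=
  Finsupp.liftAddHom fun φ => zmultiplesHom _ (Additive.ofMul (u φ))

theorem unitsEval_single {k Φ : Type*} [Field k] (u : Φ → kˣ) (φ : Φ) :
    unitsEval u (Finsupp.single φ 1) = Additive.ofMul (u φ) := by
  simp [unitsEval]

theorem toMul_unitsEval {k Φ : Type*} [Field k] [Fintype Φ] (u : Φ → kˣ) (m : Φ →₀ ℤ) :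
    (unitsEval u m).toMul = ∏ φ, u φ ^ m φ := by
  simp [unitsEval, Finsupp.sum_fintype, toMul_sum]

theorem evalMon_units_mul {k Φ : Type*} [Field k] [Fintype Φ] {F F' : Φ → k} {u : Φ → kˣ}
    (hu : ∀ φ, F' φ = u φ * F φ) (m : Φ →₀ ℤ) :
    evalMon F' m = ((unitsEval u m).toMul : kˣ) * evalMon F m := by
  simp [evalMon, toMul_unitsEval, hu, mul_zpow, Finset.prod_mul_distrib]

/-- Every additive homomorphism on `Γ →₀ ℤ` with values in `Additive kˣ` is evaluation at its
values on the standard basis. -/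
theorem eq_unitsEval {k Γ : Type*} [Field k] (e : (Γ →₀ ℤ) →+ Additive kˣ) :
    e = unitsEval fun γ => (e (Finsupp.single γ 1)).toMul := by
  ext γ
  simp [unitsEval]

/-- Any two distinct gauge classes with a common zero set are separated by the evaluation of
some invariant monomial supported away from the zero set. -/
theorem exists_separating_invariant_monomial {k : Type*} [Field k] [IsAlgClosed k] [CharZero k]
    {Φ Γ : Type*} [Fintype Φ] [Fintype Γ] (t : Φ → (Γ →₀ ℤ)) (F F' : Φ → k)
    (hne : ¬ gaugeEquiv t F F') (hz : {φ : Φ | F φ = 0} = {φ : Φ | F' φ = 0}) :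
    ∃ m : Φ →₀ ℤ, tA t m = 0 ∧ (∀ φ ∈ m.support, F φ ≠ 0) ∧
      evalMon F m ≠ evalMon F' m := by
  obtain ⟨u, hu⟩ := exists_units_mul_eq_of_zero_set_eq fun φ => Set.ext_iff.mp hz φ
  by_contra! hsep
  let P : Submodule ℤ (Φ →₀ ℤ) := Finsupp.supported ℤ ℤ {φ | F φ ≠ 0}
  have hker : LinearMap.ker ((tA t).toIntLinearMap.domRestrict P) ≤
      LinearMap.ker ((unitsEval u).toIntLinearMap.domRestrict P) := by
    rintro ⟨m, hm⟩ hm0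
    have hsupp : ∀ φ ∈ m.support, F φ ≠ 0 := fun φ hφ => hm hφ
    have heq := hsep m hm0 hsupp
    rw [evalMon_units_mul hu, right_eq_mul₀ (evalMon_ne_zero hsupp), Units.val_eq_one] at heq
    exact heq
  obtain ⟨e, he⟩ := (IsAlgClosed.baer_additive_units k).exists_comp_eq_of_ker_le _ _ hker
  refine hne ⟨fun γ => (e (Finsupp.single γ 1)).toMul, funext fun φ => ?_⟩
  by_cases h0 : F φ = 0
  · simp [gaugeAct, hu, h0]
  have hφ : Finsupp.single φ (1 : ℤ) ∈ P := Finsupp.single_mem_supported ℤ 1 h0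
  have hval : e.toAddMonoidHom (t φ) = Additive.ofMul (u φ) := by
    rw [← tA_single t φ, ← unitsEval_single u φ]
    exact LinearMap.congr_fun he ⟨_, hφ⟩
  rw [eq_unitsEval e.toAddMonoidHom] at hval
  have hprod := toMul_unitsEval (fun γ => (e (Finsupp.single γ 1)).toMul) (t φ)
  rw [gaugeAct, ← hprod, hu φ]
  exact congrArg (fun a : Additive kˣ => (a.toMul : k) * F φ) hval.symm
end
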